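/- arXiv:2106.10527 — 2 statements merged into one kernel-verified Lean document; each statement's English description precedes it below -/
import Mathlib

section
/- (Witt's theorem for quaternions) Let H₁, H₂ ∈ ℍ^{n×n} be invertible Hermitian with π(H₁) = π(H₂) (equal numbers of positive eigenvalues). Let V₁, V₂ be subspaces of ℍⁿ and U₀ : V₁ → V₂ an invertible linear map with [U₀x, U₀y]₂ = [x,y]₁ for all x,y ∈ V₁. Then there exists a linear map U : ℍⁿ → ℍⁿ with [Ux, Uy]₂ = [x,y]₁ for all x,y ∈ ℍⁿ and Ux = U₀x for all x ∈ V₁. -/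
open Quaternion Matrix

/-- The indefinite inner product `[x,y] = y* H x` on `ℍⁿ`. -/
noncomputable def qform {n : ℕ} (H : Matrix (Fin n) (Fin n) ℍ[ℝ]) (x y : Fin n → ℍ[ℝ]) : ℍ[ℝ] :=
  star y ⬝ᵥ (H *ᵥ x)

/-- The inner product defined by `H` is positive definite on the subspace `W`. -/
def qPosDefOn {n : ℕ} (H : Matrix (Fin n) (Fin n) ℍ[ℝ])
    (W : Submodule ℍ[ℝ]ᵐᵒᵖ (Fin n → ℍ[ℝ])) : Prop :=
  ∀ x ∈ W, x ≠ 0 → ∃ r : ℝ, 0 < r ∧ qform H x x = (r : ℍ[ℝ])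

open MulOpposite

section Form

variable {n : ℕ} {H : Matrix (Fin n) (Fin n) ℍ[ℝ]}

theorem qform_add_left (x x' y : Fin n → ℍ[ℝ]) :
    qform H (x + x') y = qform H x y + qform H x' y := by
  simp [qform, mulVec_add]

theorem qform_add_right (x y y' : Fin n → ℍ[ℝ]) :
    qform H x (y + y') = qform H x y + qform H x y' := by
  simp [qform]

theorem qform_sub_left (x x' y : Fin n → ℍ[ℝ]) :
    qform H (x - x') y = qform H x y - qform H x' y := by
  simp [qform, mulVec_sub]

theorem qform_sub_right (x y y' : Fin n → ℍ[ℝ]) :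
    qform H x (y - y') = qform H x y - qform H x y' := by
  simp [qform]

theorem qform_smul_left (c : ℍ[ℝ]ᵐᵒᵖ) (x y : Fin n → ℍ[ℝ]) :
    qform H (c • x) y = qform H x y * unop c := by
  simp [qform, mulVec_smul, dotProduct_smul]

theorem qform_smul_right (c : ℍ[ℝ]ᵐᵒᵖ) (x y : Fin n → ℍ[ℝ]) :
    qform H x (c • y) = star (unop c) * qform H x y := by
  simp [qform, dotProduct, Finset.mul_sum, mul_assoc]

theorem qform_zero_left (y : Fin n → ℍ[ℝ]) : qform H 0 y = 0 := by simp [qform]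

theorem qform_zero_right (x : Fin n → ℍ[ℝ]) : qform H x 0 = 0 := by simp [qform]

theorem qform_sum_left {ι : Type*} (s : Finset ι) (f : ι → Fin n → ℍ[ℝ]) (y : Fin n → ℍ[ℝ]) :
    qform H (∑ i ∈ s, f i) y = ∑ i ∈ s, qform H (f i) y :=
  map_sum (AddMonoidHom.mk' (fun x => qform H x y) fun x x' => qform_add_left x x' y) f s

theorem qform_sum_right {ι : Type*} (s : Finset ι) (f : ι → Fin n → ℍ[ℝ]) (x : Fin n → ℍ[ℝ]) :
    qform H x (∑ i ∈ s, f i) = ∑ i ∈ s, qform H x (f i) :=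
  map_sum (AddMonoidHom.mk' (fun y => qform H x y) fun y y' => qform_add_right x y y') f s

theorem star_qform (hH : H.IsHermitian) (x y : Fin n → ℍ[ℝ]) :
    star (qform H x y) = qform H y x := by
  rw [qform, qform, ← star_dotProduct_star, star_star, star_mulVec, hH.eq, dotProduct_mulVec]

theorem qform_eq_zero_comm (hH : H.IsHermitian) {x y : Fin n → ℍ[ℝ]} :
    qform H x y = 0 ↔ qform H y x = 0 := by
  rw [← star_qform hH, star_eq_zero]

/-- Every linear functional on `ℍⁿ` is represented by an invertible form. -/
theorem exists_qform_eq {K : Matrix (Fin n) (Fin n) ℍ[ℝ]} (hK : K * H = 1)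
    (φ : (Fin n → ℍ[ℝ]) →ₗ[ℍ[ℝ]ᵐᵒᵖ] ℍ[ℝ]ᵐᵒᵖ) :
    ∃ f : Fin n → ℍ[ℝ], ∀ x, qform H x f = unop (φ x) := by
  set r : Fin n → ℍ[ℝ] := fun i => unop (φ (Pi.single i 1))
  refine ⟨star (r ᵥ* K), fun x => ?_⟩
  have hx : x = ∑ i, op (x i) • (Pi.single i 1 : Fin n → ℍ[ℝ]) := by
    ext1 j
    simp [Finset.sum_apply, Pi.single_apply]
  rw [qform, star_star, dotProduct_mulVec, vecMul_vecMul, hK, vecMul_one]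
  conv_rhs => rw [hx]
  simp [dotProduct, r]

theorem exists_qform_ne_zero {K : Matrix (Fin n) (Fin n) ℍ[ℝ]}
    (hK : K * H = 1) {W : Submodule ℍ[ℝ]ᵐᵒᵖ (Fin n → ℍ[ℝ])} {v : Fin n → ℍ[ℝ]} (hv : v ∉ W) :
    ∃ f, (∀ w ∈ W, qform H w f = 0) ∧ qform H v f ≠ 0 := by
  obtain ⟨φ, hφv, hφW⟩ := Submodule.exists_le_ker_of_notMem hv
  obtain ⟨f, hf⟩ := exists_qform_eq hK φ
  refine ⟨f, fun w hw => ?_, ?_⟩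
  · rw [hf, LinearMap.mem_ker.1 (hφW hw), unop_zero]
  · rwa [hf, Ne, unop_eq_zero_iff]

theorem eq_zero_of_qform_eq_zero {K : Matrix (Fin n) (Fin n) ℍ[ℝ]}
    (hK : K * H = 1) {x : Fin n → ℍ[ℝ]} (hx : ∀ y, qform H x y = 0) : x = 0 := by
  have h : H *ᵥ x = 0 := by
    ext1 i
    simpa [qform] using hx (Pi.single i 1)
  rw [← one_mulVec x, ← hK, ← mulVec_mulVec, h, mulVec_zero]

/-- A quasi-reflection along `v - u` carries `v` to `u` and fixes the complement of `v - u`. -/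
theorem exists_isometry_of_qform_sub_ne_zero (hH : H.IsHermitian) {u v : Fin n → ℍ[ℝ]}
    (huv : qform H u u = qform H v v) (hd : qform H v (v - u) ≠ 0) :
    ∃ T : (Fin n → ℍ[ℝ]) →ₗ[ℍ[ℝ]ᵐᵒᵖ] (Fin n → ℍ[ℝ]),
      (∀ x y, qform H (T x) (T y) = qform H x y) ∧ T v = u ∧
      ∀ w, qform H w (v - u) = 0 → T w = w := by
  set d := v - u with hd_def
  set b := qform H v d with hb
  have hdd : qform H d d = b + star b := by
    rw [hb, star_qform hH, hd_def]
    simp only [qform_sub_left, qform_sub_right, huv]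
    abel
  let T : (Fin n → ℍ[ℝ]) →ₗ[ℍ[ℝ]ᵐᵒᵖ] (Fin n → ℍ[ℝ]) :=
    { toFun := fun x => x - op (b⁻¹ * qform H x d) • d
      map_add' := fun x y => by
        rw [qform_add_left, mul_add, op_add, add_smul]; abel
      map_smul' := fun c x => by
        simp [qform_smul_left, smul_sub, smul_smul, ← mul_assoc] }
  have hT : ∀ x, T x = x - op (b⁻¹ * qform H x d) • d := fun _ => rfl
  refine ⟨T, fun x y => ?_, ?_, fun w hw => ?_⟩
  · have hsb : star b ≠ 0 := star_ne_zero.2 hd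
    rw [hT, hT]
    simp only [qform_sub_left, qform_sub_right, qform_smul_left, qform_smul_right, unop_op, hdd,
      star_mul, star_inv₀, star_qform hH]
    have : qform H d y * (star b)⁻¹ * ((b + star b) * (b⁻¹ * qform H x d)) =
        qform H d y * (b⁻¹ * qform H x d) + qform H d y * (star b)⁻¹ * qform H x d := by
      rw [add_mul, mul_inv_cancel_left₀ hd, mul_add, mul_assoc _ _ (star b * _),
        inv_mul_cancel_left₀ hsb, add_comm]
    rw [mul_sub, this]
    abel
  · rw [hT, inv_mul_cancel₀ hd, op_one, one_smul, hd_def, sub_sub_cancel]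
  · rw [hT, hw]; simp

/-- Two vectors outside a subspace `W` share a non-orthogonal vector in the complement of `W`. -/
theorem exists_orthogonal_qform_ne_zero {K : Matrix (Fin n) (Fin n) ℍ[ℝ]}
    (hK : K * H = 1) {W : Submodule ℍ[ℝ]ᵐᵒᵖ (Fin n → ℍ[ℝ])} {u v : Fin n → ℍ[ℝ]}
    (hu : u ∉ W) (hv : v ∉ W) :
    ∃ f, (∀ w ∈ W, qform H w f = 0) ∧ qform H v f ≠ 0 ∧ qform H u f ≠ 0 := by
  obtain ⟨f, hfW, hf⟩ := exists_qform_ne_zero hK hv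
  obtain ⟨g, hgW, hg⟩ := exists_qform_ne_zero hK hu
  by_cases h₁ : qform H u f = 0
  · by_cases h₂ : qform H v g = 0
    · exact ⟨f + g, fun w hw => by rw [qform_add_right, hfW w hw, hgW w hw, add_zero],
        by rwa [qform_add_right, h₂, add_zero], by rwa [qform_add_right, h₁, zero_add]⟩
    · exact ⟨g, hgW, h₂, hg⟩
  · exact ⟨f, hfW, hf, h₁⟩

/-- Along any non-orthogonal direction `f`, a vector `v` can be moved without changing
its length. -/
theorem exists_smul_qform_add_eq (hH : H.IsHermitian) {f v : Fin n → ℍ[ℝ]}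
    (hf : qform H v f ≠ 0) :
    ∃ c : ℍ[ℝ]ᵐᵒᵖ, c ≠ 0 ∧ qform H (v + c • f) (v + c • f) = qform H v v := by
  have hstar : star (qform H v f) = qform H f v := star_qform hH v f
  have hfv : qform H f v ≠ 0 := by rwa [← hstar, star_ne_zero]
  by_cases hff : qform H f f = 0
  · set i : ℍ[ℝ] := ⟨0, 1, 0, 0⟩
    have hi : star i = -i := Quaternion.star_eq_neg.2 rfl
    have hi0 : i ≠ 0 := fun h => by simpa [i] using congrArg QuaternionAlgebra.imI h
    refine ⟨op ((qform H f v)⁻¹ * i), by simp [hfv, hi0], ?_⟩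
    simp only [qform_add_left, qform_add_right, qform_smul_left, qform_smul_right, hff, unop_op,
      star_mul, star_inv₀, star_qform hH, hi, zero_mul, add_zero]
    rw [mul_inv_cancel_left₀ hfv, mul_assoc, inv_mul_cancel₀ hf]
    simp
  · have hs : star (qform H f f) = qform H f f := star_qform hH f f
    set t := (qform H f f)⁻¹ * qform H v f with ht
    have ht0 : t + t ≠ 0 := by
      rw [← two_smul ℝ t]
      exact smul_ne_zero two_ne_zero (mul_ne_zero (inv_ne_zero hff) hf)
    refine ⟨op (-(t + t)), (op_ne_zero_iff _).2 (neg_ne_zero.2 ht0), ?_⟩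
    simp only [qform_add_left, qform_add_right, qform_smul_left, qform_smul_right, unop_op,
      star_neg, star_add, ht, star_mul, star_inv₀, hs, star_qform hH]
    simp only [neg_mul, mul_neg, mul_add, add_mul, mul_assoc, mul_inv_cancel_left₀ hff]
    abel

theorem injective_of_isometry {H' : Matrix (Fin n) (Fin n) ℍ[ℝ]}
    {K : Matrix (Fin n) (Fin n) ℍ[ℝ]} (hK : K * H = 1)
    {T : (Fin n → ℍ[ℝ]) →ₗ[ℍ[ℝ]ᵐᵒᵖ] (Fin n → ℍ[ℝ])}
    (hT : ∀ x y, qform H' (T x) (T y) = qform H x y) : Function.Injective T := by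
  refine (injective_iff_map_eq_zero T).2 fun x hx => eq_zero_of_qform_eq_zero hK fun y => ?_
  rw [← hT, hx, qform_zero_left]

/-- Extension of an isometry that is the identity on `W` by one further vector. -/
theorem exists_isometry_fixing (hH : H.IsHermitian) {K : Matrix (Fin n) (Fin n) ℍ[ℝ]}
    (hK : K * H = 1) {W : Submodule ℍ[ℝ]ᵐᵒᵖ (Fin n → ℍ[ℝ])} {u v : Fin n → ℍ[ℝ]}
    (hu : u ∉ W) (hv : v ∉ W) (huv : qform H u u = qform H v v)
    (hW : ∀ w ∈ W, qform H w u = qform H w v) :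
    ∃ T : (Fin n → ℍ[ℝ]) →ₗ[ℍ[ℝ]ᵐᵒᵖ] (Fin n → ℍ[ℝ]),
      (∀ x y, qform H (T x) (T y) = qform H x y) ∧ T v = u ∧ ∀ w ∈ W, T w = w := by
  by_cases hd : qform H v (v - u) = 0
  · obtain ⟨f, hfW, hfv, hfu⟩ := exists_orthogonal_qform_ne_zero hK hu hv
    obtain ⟨c, hc, hcv⟩ := exists_smul_qform_add_eq hH hfv
    set z := v + c • f with hz
    have hc' : star (unop c) ≠ 0 := by simpa using hc
    have hvz : v - z = -(c • f) := by rw [hz]; abel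
    have hneg : ∀ x, qform H x (-(c • f)) = -(star (unop c) * qform H x f) := fun x => by
      rw [← zero_sub, qform_sub_right, qform_zero_right, qform_smul_right, zero_sub]
    obtain ⟨T₁, hT₁, hT₁v, hT₁W⟩ := exists_isometry_of_qform_sub_ne_zero hH hcv
      (by rw [hvz, hneg]; exact neg_ne_zero.2 (mul_ne_zero hc' hfv))
    have hu' : qform H u (u - z) ≠ 0 := by
      have h₁ : qform H u v = qform H u u := by
        rw [qform_sub_right, sub_eq_zero] at hd
        rw [← star_qform hH v u, ← hd, star_qform hH, huv]
      rw [hz, qform_sub_right, qform_add_right, h₁, sub_add_cancel_left, qform_smul_right]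
      exact neg_ne_zero.2 (mul_ne_zero hc' hfu)
    have hu'' : qform H z (z - u) ≠ 0 := by
      intro h
      apply hu'
      rw [qform_sub_right, sub_eq_zero] at h ⊢
      rw [← star_qform hH z u, ← h, star_qform hH, hcv, huv]
    obtain ⟨T₂, hT₂, hT₂z, hT₂W⟩ := exists_isometry_of_qform_sub_ne_zero hH
      (huv.trans hcv.symm) hu''
    refine ⟨T₂ ∘ₗ T₁, fun x y => by simp [hT₁, hT₂], by simp [hT₁v, hT₂z], fun w hw => ?_⟩
    rw [LinearMap.comp_apply, hT₁W, hT₂W]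
    · rw [hz, qform_sub_right, qform_add_right, qform_smul_right, hfW w hw, hW w hw]
      simp
    · rw [hvz, hneg, hfW w hw]
      simp
  · obtain ⟨T, hT, hTv, hTW⟩ := exists_isometry_of_qform_sub_ne_zero hH huv hd
    exact ⟨T, hT, hTv, fun w hw => hTW w (by rw [qform_sub_right, hW w hw, sub_self])⟩

/-- `ℍ` as a one-dimensional right vector space over itself. -/
noncomputable def quaternionOpEquiv : ℍ[ℝ] ≃ₗ[ℍ[ℝ]ᵐᵒᵖ] ℍ[ℝ]ᵐᵒᵖ :=
  { opAddEquiv with map_smul' := fun c x => by simp }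

noncomputable instance : Module.Finite ℍ[ℝ]ᵐᵒᵖ ℍ[ℝ] := Module.Finite.equiv quaternionOpEquiv.symm

theorem finrank_quaternion_pi : Module.finrank ℍ[ℝ]ᵐᵒᵖ (Fin n → ℍ[ℝ]) = n := by
  rw [(LinearEquiv.piCongrRight fun _ : Fin n => quaternionOpEquiv).finrank_eq]
  simp

/-- Witt's extension theorem for a single form, with the partial isometry given as the
restriction of a linear map to the span of a finite set. -/
theorem exists_isometry_eqOn_span (hH : H.IsHermitian) {K : Matrix (Fin n) (Fin n) ℍ[ℝ]}
    (hK : K * H = 1) (f : (Fin n → ℍ[ℝ]) →ₗ[ℍ[ℝ]ᵐᵒᵖ] (Fin n → ℍ[ℝ])) {s : Set (Fin n → ℍ[ℝ])}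
    (hs : s.Finite) (hinj : ∀ x ∈ Submodule.span ℍ[ℝ]ᵐᵒᵖ s, f x = 0 → x = 0)
    (hf : ∀ x ∈ Submodule.span ℍ[ℝ]ᵐᵒᵖ s, ∀ y ∈ Submodule.span ℍ[ℝ]ᵐᵒᵖ s,
      qform H (f x) (f y) = qform H x y) :
    ∃ U : (Fin n → ℍ[ℝ]) ≃ₗ[ℍ[ℝ]ᵐᵒᵖ] (Fin n → ℍ[ℝ]),
      (∀ x y, qform H (U x) (U y) = qform H x y) ∧
      ∀ x ∈ Submodule.span ℍ[ℝ]ᵐᵒᵖ s, U x = f x := by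
  induction s, hs using Set.Finite.induction_on with
  | empty =>
    refine ⟨LinearEquiv.refl _ _, fun _ _ => rfl, fun x hx => ?_⟩
    rw [Submodule.span_empty, Submodule.mem_bot] at hx
    simp [hx]
  | @insert v s _ _ ih =>
    set W := Submodule.span ℍ[ℝ]ᵐᵒᵖ s with hWdef
    have hle : W ≤ Submodule.span ℍ[ℝ]ᵐᵒᵖ (insert v s) :=
      Submodule.span_mono (Set.subset_insert v s)
    have hvmem : v ∈ Submodule.span ℍ[ℝ]ᵐᵒᵖ (insert v s) :=
      Submodule.subset_span (Set.mem_insert v s)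
    obtain ⟨U, hU, hUW⟩ := ih (fun x hx => hinj x (hle hx))
      (fun x hx y hy => hf x (hle hx) y (hle hy))
    by_cases hv : v ∈ W
    · exact ⟨U, hU, fun x hx => hUW x (by rwa [Submodule.span_insert_eq_span hv] at hx)⟩
    have hUsymm : ∀ x y, qform H (U.symm x) (U.symm y) = qform H x y := fun x y => by
      rw [← hU, U.apply_symm_apply, U.apply_symm_apply]
    have hfix : ∀ w ∈ W, U.symm (f w) = w := fun w hw => by
      rw [← hUW w hw, U.symm_apply_apply]
    have hu : U.symm (f v) ∉ W := fun hu => by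
      have h := hfix _ hu
      rw [EmbeddingLike.apply_eq_iff_eq] at h
      have h0 := hinj _ (Submodule.sub_mem _ (hle hu) hvmem) (by rw [map_sub, h, sub_self])
      rw [sub_eq_zero] at h0
      exact hv (h0 ▸ hu)
    obtain ⟨T, hT, hTv, hTW⟩ := exists_isometry_fixing hH hK hu hv
      (by rw [hUsymm, hf v hvmem v hvmem]) (fun w hw => by
        conv_lhs => rw [← hfix w hw]
        rw [hUsymm, hf w (hle hw) v hvmem])
    refine ⟨(LinearEquiv.ofInjectiveEndo T (injective_of_isometry hK hT)).trans U,
      fun x y => by simp [hU, hT], fun x hx => ?_⟩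
    obtain ⟨a, w, hw, rfl⟩ := Submodule.mem_span_insert.1 hx
    simp [hTv, hTW w hw, hUW w hw]

/-- A family of pairwise orthogonal vectors of lengths `ε i = ±1`. -/
structure IsSignedFrame {ι : Type*} (H : Matrix (Fin n) (Fin n) ℍ[ℝ]) (e : ι → Fin n → ℍ[ℝ])
    (ε : ι → ℝ) : Prop where
  sign : ∀ i, ε i = 1 ∨ ε i = -1
  self : ∀ i, qform H (e i) (e i) = (ε i : ℍ[ℝ])
  ortho : ∀ i j, i ≠ j → qform H (e i) (e j) = 0

namespace IsSignedFrame

variable {ι : Type*} {e : ι → Fin n → ℍ[ℝ]} {ε : ι → ℝ}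

theorem comp (h : IsSignedFrame H e ε) {κ : Type*} {f : κ → ι} (hf : Function.Injective f) :
    IsSignedFrame H (e ∘ f) (ε ∘ f) :=
  ⟨fun _ => h.sign _, fun _ => h.self _, fun _ _ hij => h.ortho _ _ (hf.ne hij)⟩

theorem coe_ne_zero (h : IsSignedFrame H e ε) (i : ι) : (ε i : ℍ[ℝ]) ≠ 0 := by
  rcases h.sign i with hi | hi <;> simp [hi]

theorem coe_mul_self (h : IsSignedFrame H e ε) (i : ι) : (ε i : ℍ[ℝ]) * ε i = 1 := by
  rcases h.sign i with hi | hi <;> simp [hi]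

variable [Fintype ι]

theorem qform_sum_smul (h : IsSignedFrame H e ε) (c : ι → ℍ[ℝ]ᵐᵒᵖ) (j : ι) :
    qform H (∑ i, c i • e i) (e j) = ε j * unop (c j) := by
  rw [qform_sum_left, Finset.sum_eq_single j, qform_smul_left, h.self]
  · intro i _ hij
    rw [qform_smul_left, h.ortho i j hij, zero_mul]
  · simp

theorem qform_sum_smul_sum_smul (h : IsSignedFrame H e ε) (c d : ι → ℍ[ℝ]ᵐᵒᵖ) :
    qform H (∑ i, c i • e i) (∑ i, d i • e i) =
      ∑ i, star (unop (d i)) * (ε i * unop (c i)) := by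
  rw [qform_sum_right]
  exact Finset.sum_congr rfl fun j _ => by rw [qform_smul_right, h.qform_sum_smul]

theorem qform_sum_smul_self (h : IsSignedFrame H e ε) (c : ι → ℍ[ℝ]ᵐᵒᵖ) :
    qform H (∑ i, c i • e i) (∑ i, c i • e i) =
      ((∑ i, ε i * normSq (unop (c i)) : ℝ) : ℍ[ℝ]) := by
  rw [h.qform_sum_smul_sum_smul]
  refine Eq.trans ?_ (map_sum (algebraMap ℝ ℍ[ℝ]) _ _).symm
  refine Finset.sum_congr rfl fun i _ => ?_
  change _ = ((ε i * normSq (unop (c i)) : ℝ) : ℍ[ℝ])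
  rw [← mul_assoc, ← Quaternion.coe_commutes, mul_assoc,
    Quaternion.star_mul_self, Quaternion.coe_mul]

theorem linearIndependent (h : IsSignedFrame H e ε) : LinearIndependent ℍ[ℝ]ᵐᵒᵖ e := by
  refine Fintype.linearIndependent_iff.2 fun c hc j => ?_
  have hj := h.qform_sum_smul c j
  rw [hc, qform_zero_left, eq_comm, mul_eq_zero, unop_eq_zero_iff] at hj
  exact hj.resolve_left (h.coe_ne_zero j)

theorem qPosDefOn_span (h : IsSignedFrame H e ε) (hε : ∀ i, ε i = 1) :
    qPosDefOn H (Submodule.span ℍ[ℝ]ᵐᵒᵖ (Set.range e)) := by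
  intro x hx hx0
  obtain ⟨c, rfl⟩ := (Submodule.mem_span_range_iff_exists_fun _).1 hx
  refine ⟨_, ?_, h.qform_sum_smul_self c⟩
  obtain ⟨j, hj⟩ : ∃ j, c j ≠ 0 := by
    by_contra! hc
    exact hx0 (by simp [hc])
  refine Finset.sum_pos' (fun i _ => ?_) ⟨j, Finset.mem_univ j, ?_⟩
  · rw [hε, one_mul]
    exact normSq_nonneg
  · rw [hε, one_mul]
    exact normSq_nonneg.lt_of_ne' (by simpa using hj)

theorem disjoint_span_of_qPosDefOn (h : IsSignedFrame H e ε) (hε : ∀ i, ε i = -1)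
    {W : Submodule ℍ[ℝ]ᵐᵒᵖ (Fin n → ℍ[ℝ])} (hW : qPosDefOn H W) :
    Disjoint W (Submodule.span ℍ[ℝ]ᵐᵒᵖ (Set.range e)) := by
  refine Submodule.disjoint_def.2 fun x hxW hx => ?_
  by_contra hx0
  obtain ⟨r, hr, hxr⟩ := hW x hxW hx0
  obtain ⟨c, rfl⟩ := (Submodule.mem_span_range_iff_exists_fun _).1 hx
  rw [h.qform_sum_smul_self c, Quaternion.coe_inj] at hxr
  rw [← hxr] at hr
  refine hr.not_ge (Finset.sum_nonpos fun i _ => ?_)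
  rw [hε, neg_one_mul, neg_nonpos]
  exact normSq_nonneg

/-- A frame with fewer than `n` vectors has a non-isotropic vector orthogonal to it. -/
theorem exists_orthogonal_qform_self_ne_zero (h : IsSignedFrame H e ε) (hH : H.IsHermitian)
    {K : Matrix (Fin n) (Fin n) ℍ[ℝ]} (hK : K * H = 1) (hι : Fintype.card ι < n) :
    ∃ x, (∀ i, qform H x (e i) = 0) ∧ qform H x x ≠ 0 := by
  by_contra! hiso
  have hort : ∀ x y, (∀ i, qform H x (e i) = 0) → (∀ i, qform H y (e i) = 0) →
      qform H x y = 0 := by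
    intro x y hx hy
    by_contra hxy
    have hadd := hiso (x + op (star (qform H x y)⁻¹) • y) fun i => by
      rw [qform_add_left, qform_smul_left, hx, hy, zero_mul, add_zero]
    simp only [qform_add_left, qform_add_right, qform_smul_left, qform_smul_right, hiso x hx,
      hiso y hy, unop_op, star_star, inv_mul_cancel₀ hxy, zero_mul, add_zero, zero_add] at hadd
    rw [← star_qform hH x y, ← star_mul, inv_mul_cancel₀ hxy, star_one] at hadd
    simpa using congrArg QuaternionAlgebra.re hadd
  have hproj : ∀ y i, qform H (y - ∑ j, op (ε j * qform H y (e j)) • e j) (e i) = 0 := by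
    intro y i
    rw [qform_sub_left, h.qform_sum_smul, unop_op, ← mul_assoc, h.coe_mul_self, one_mul, sub_self]
  have hzero : ∀ x, (∀ i, qform H x (e i) = 0) → x = 0 := by
    refine fun x hx => eq_zero_of_qform_eq_zero hK fun y => ?_
    have h₁ := hort x _ hx (hproj y)
    rw [qform_sub_right, qform_sum_right, Finset.sum_eq_zero, sub_zero] at h₁
    · exact h₁
    · intro i _
      rw [qform_smul_right, hx, mul_zero]
  have htop : Submodule.span ℍ[ℝ]ᵐᵒᵖ (Set.range e) = ⊤ := by
    refine Submodule.eq_top_iff'.2 fun y => ?_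
    rw [sub_eq_zero.1 (hzero _ (hproj y))]
    exact Submodule.sum_mem _ fun i _ =>
      Submodule.smul_mem _ _ (Submodule.subset_span (Set.mem_range_self i))
  have hcard := finrank_range_le_card (R := ℍ[ℝ]ᵐᵒᵖ) e
  rw [Set.finrank, htop, finrank_top, finrank_quaternion_pi] at hcard
  exact absurd hcard hι.not_ge

end IsSignedFrame

theorem exists_smul_qform_self (hH : H.IsHermitian) {x : Fin n → ℍ[ℝ]} (hx : qform H x x ≠ 0) :
    ∃ (c : ℍ[ℝ]ᵐᵒᵖ) (ε : ℝ), (ε = 1 ∨ ε = -1) ∧ qform H (c • x) (c • x) = (ε : ℍ[ℝ]) := by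
  obtain ⟨r, hr⟩ : ∃ r : ℝ, qform H x x = (r : ℍ[ℝ]) :=
    ⟨_, Quaternion.star_eq_self.1 (star_qform hH x x)⟩
  have hr0 : r ≠ 0 := by
    rintro rfl
    exact hx (by simpa using hr)
  have hs : √|r| * √|r| = |r| := Real.mul_self_sqrt (abs_nonneg r)
  refine ⟨op (((√|r|)⁻¹ : ℝ) : ℍ[ℝ]), r / |r|, ?_, ?_⟩
  · rcases hr0.lt_or_gt with h | h
    · right; rw [abs_of_neg h, div_neg, div_self hr0]
    · left; rw [abs_of_pos h, div_self hr0]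
  · rw [qform_smul_left, qform_smul_right, hr, unop_op, Quaternion.star_coe, ← Quaternion.coe_mul,
      ← Quaternion.coe_mul, Quaternion.coe_inj, mul_right_comm, ← mul_inv, hs]
    exact (div_eq_inv_mul _ _).symm

theorem exists_isSignedFrame (hH : H.IsHermitian) {K : Matrix (Fin n) (Fin n) ℍ[ℝ]}
    (hK : K * H = 1) (k : ℕ) (hk : k ≤ n) :
    ∃ (e : Fin k → Fin n → ℍ[ℝ]) (ε : Fin k → ℝ), IsSignedFrame H e ε := by
  induction k with
  | zero => exact ⟨Fin.elim0, Fin.elim0, fun i => i.elim0, fun i => i.elim0, fun i => i.elim0⟩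
  | succ k ih =>
    obtain ⟨e, ε, h⟩ := ih (Nat.le_of_succ_le hk)
    obtain ⟨x, hxe, hxx⟩ := h.exists_orthogonal_qform_self_ne_zero hH hK (by simpa using hk)
    obtain ⟨c, δ, hδ, hc⟩ := exists_smul_qform_self hH hxx
    have hce : ∀ i, qform H (c • x) (e i) = 0 := fun i => by
      rw [qform_smul_left, hxe, zero_mul]
    refine ⟨Fin.cons (c • x) e, Fin.cons δ ε, ?_, ?_, ?_⟩
    · exact Fin.cases hδ h.sign
    · exact Fin.cases hc h.self
    · refine Fin.cases (Fin.cases (fun h => absurd rfl h) fun j _ => hce j) fun i =>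
        Fin.cases (fun _ => (qform_eq_zero_comm hH).1 (hce i)) fun j hij =>
          h.ortho i j (by simpa using hij)

/-- The number of positive signs in a full frame bounds the dimension of positive subspaces. -/
theorem IsSignedFrame.finrank_le {e : Fin n → Fin n → ℍ[ℝ]} {ε : Fin n → ℝ}
    (h : IsSignedFrame H e ε) {W : Submodule ℍ[ℝ]ᵐᵒᵖ (Fin n → ℍ[ℝ])} (hW : qPosDefOn H W) :
    Module.finrank ℍ[ℝ]ᵐᵒᵖ W ≤ Fintype.card {i // ε i = 1} := by
  have hneg := h.comp (Subtype.val_injective (p := fun i => ¬ ε i = 1))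
  have hdisj := hneg.disjoint_span_of_qPosDefOn (fun i => (h.sign i).resolve_left i.2) hW
  have hle := Submodule.finrank_add_finrank_le_of_disjoint hdisj
  rw [finrank_span_eq_card hneg.linearIndependent, finrank_quaternion_pi,
    Fintype.card_subtype_compl, Fintype.card_fin] at hle
  have := Fintype.card_subtype_le fun i => ε i = 1
  rw [Fintype.card_fin] at this
  omega

theorem IsSignedFrame.exists_qPosDefOn {e : Fin n → Fin n → ℍ[ℝ]} {ε : Fin n → ℝ}
    (h : IsSignedFrame H e ε) :
    ∃ W : Submodule ℍ[ℝ]ᵐᵒᵖ (Fin n → ℍ[ℝ]), qPosDefOn H W ∧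
      Module.finrank ℍ[ℝ]ᵐᵒᵖ W = Fintype.card {i // ε i = 1} := by
  have hpos := h.comp (Subtype.val_injective (p := fun i => ε i = 1))
  exact ⟨_, hpos.qPosDefOn_span Subtype.prop, finrank_span_eq_card hpos.linearIndependent⟩

/-- Two full frames with the same signs give an isometry. -/
theorem IsSignedFrame.exists_isometry {H' : Matrix (Fin n) (Fin n) ℍ[ℝ]}
    {e e' : Fin n → Fin n → ℍ[ℝ]} {ε : Fin n → ℝ} (h : IsSignedFrame H e ε)
    (h' : IsSignedFrame H' e' ε) :
    ∃ T : (Fin n → ℍ[ℝ]) →ₗ[ℍ[ℝ]ᵐᵒᵖ] (Fin n → ℍ[ℝ]),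
      ∀ x y, qform H' (T x) (T y) = qform H x y := by
  let b : Module.Basis (Fin n) ℍ[ℝ]ᵐᵒᵖ (Fin n → ℍ[ℝ]) :=
    Module.Basis.mk h.linearIndependent (h.linearIndependent.span_eq_top_of_card_eq_finrank'
      (by rw [finrank_quaternion_pi, Fintype.card_fin])).ge
  refine ⟨b.constr ℕ e', fun x y => ?_⟩
  rw [b.constr_apply_fintype ℕ, b.constr_apply_fintype ℕ, h'.qform_sum_smul_sum_smul,
    ← h.qform_sum_smul_sum_smul]
  have hb : ⇑b = e := Module.Basis.coe_mk _ _
  simp only [← hb, Module.Basis.equivFun_apply, b.sum_repr]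

/-- Sylvester's law of inertia: forms with positive subspaces of the same dimensions are
isometric. -/
theorem exists_isometry_of_posDef_iff {H' : Matrix (Fin n) (Fin n) ℍ[ℝ]} (hH : H.IsHermitian)
    (hH' : H'.IsHermitian) {K K' : Matrix (Fin n) (Fin n) ℍ[ℝ]} (hK : K * H = 1)
    (hK' : K' * H' = 1)
    (hpi : ∀ k : ℕ,
      (∃ W : Submodule ℍ[ℝ]ᵐᵒᵖ (Fin n → ℍ[ℝ]), qPosDefOn H W ∧ Module.finrank ℍ[ℝ]ᵐᵒᵖ W = k) ↔
      (∃ W : Submodule ℍ[ℝ]ᵐᵒᵖ (Fin n → ℍ[ℝ]), qPosDefOn H' W ∧ Module.finrank ℍ[ℝ]ᵐᵒᵖ W = k)) :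
    ∃ T : (Fin n → ℍ[ℝ]) →ₗ[ℍ[ℝ]ᵐᵒᵖ] (Fin n → ℍ[ℝ]),
      ∀ x y, qform H' (T x) (T y) = qform H x y := by
  obtain ⟨e, ε, h⟩ := exists_isSignedFrame hH hK n le_rfl
  obtain ⟨e', ε', h'⟩ := exists_isSignedFrame hH' hK' n le_rfl
  have hcard : Fintype.card {i // ε i = 1} = Fintype.card {i // ε' i = 1} := by
    refine le_antisymm ?_ ?_
    · obtain ⟨W, hW, hWk⟩ := (hpi _).1 h.exists_qPosDefOn
      exact hWk ▸ h'.finrank_le hW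
    · obtain ⟨W, hW, hWk⟩ := (hpi _).2 h'.exists_qPosDefOn
      exact hWk ▸ h.finrank_le hW
  let g := Fintype.equivOfCardEq hcard
  have hε : ε' ∘ g.extendSubtype = ε := by
    ext i
    by_cases hi : ε i = 1
    · rw [hi]
      exact g.extendSubtype_mem i hi
    · rw [(h.sign i).resolve_left hi]
      exact (h'.sign _).resolve_left (g.extendSubtype_not_mem i hi)
  exact h.exists_isometry (hε ▸ h'.comp g.extendSubtype.injective)

end Form

/-- Witt's theorem for quaternion matrices. -/
theorem stmt11 {n : ℕ} (H₁ H₂ : Matrix (Fin n) (Fin n) ℍ[ℝ])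
    (hH₁ : H₁.IsHermitian) (hH₁inv : ∃ K, H₁ * K = 1 ∧ K * H₁ = 1)
    (hH₂ : H₂.IsHermitian) (hH₂inv : ∃ K, H₂ * K = 1 ∧ K * H₂ = 1)
    -- `π(H₁) = π(H₂)`: for each `k`, `H₁` admits a `k`-dimensional positive
    -- subspace iff `H₂` does
    (hpi : ∀ k : ℕ,
      (∃ W : Submodule ℍ[ℝ]ᵐᵒᵖ (Fin n → ℍ[ℝ]), qPosDefOn H₁ W ∧ Module.finrank ℍ[ℝ]ᵐᵒᵖ W = k) ↔
      (∃ W : Submodule ℍ[ℝ]ᵐᵒᵖ (Fin n → ℍ[ℝ]), qPosDefOn H₂ W ∧ Module.finrank ℍ[ℝ]ᵐᵒᵖ W = k))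
    (V₁ V₂ : Submodule ℍ[ℝ]ᵐᵒᵖ (Fin n → ℍ[ℝ]))
    (U₀ : V₁ →ₗ[ℍ[ℝ]ᵐᵒᵖ] V₂) (hU₀bij : Function.Bijective U₀)
    (hU₀iso : ∀ x y : V₁, qform H₂ (U₀ x : Fin n → ℍ[ℝ]) (U₀ y : Fin n → ℍ[ℝ]) =
      qform H₁ (x : Fin n → ℍ[ℝ]) (y : Fin n → ℍ[ℝ])) :
    ∃ U : (Fin n → ℍ[ℝ]) →ₗ[ℍ[ℝ]ᵐᵒᵖ] (Fin n → ℍ[ℝ]),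
      (∀ x y : Fin n → ℍ[ℝ], qform H₂ (U x) (U y) = qform H₁ x y) ∧
      (∀ x : V₁, U (x : Fin n → ℍ[ℝ]) = (U₀ x : Fin n → ℍ[ℝ])) := by
  obtain ⟨K₁, -, hK₁⟩ := hH₁inv
  obtain ⟨K₂, -, hK₂⟩ := hH₂inv
  obtain ⟨T₀, hT₀⟩ := exists_isometry_of_posDef_iff hH₁ hH₂ hK₁ hK₂ hpi
  let T := LinearEquiv.ofInjectiveEndo T₀ (injective_of_isometry hK₁ hT₀)
  have hT : ∀ x y, qform H₂ (T x) (T y) = qform H₁ x y := hT₀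
  have hTsymm : ∀ x y, qform H₁ (T.symm x) (T.symm y) = qform H₂ x y := fun x y => by
    rw [← hT, T.apply_symm_apply, T.apply_symm_apply]
  obtain ⟨F, hF⟩ := LinearMap.exists_extend (V₂.subtype ∘ₗ U₀)
  have hFV : ∀ x : V₁, F x = U₀ x := fun x => LinearMap.congr_fun hF x
  obtain ⟨s, hs, rfl⟩ := Submodule.fg_def.1 (IsNoetherian.noetherian V₁)
  obtain ⟨U, hU, hUF⟩ := exists_isometry_eqOn_span hH₁ hK₁ (T.symm.toLinearMap ∘ₗ F) hs
    (fun x hx h0 => by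
      have h : U₀ ⟨x, hx⟩ = 0 := by
        rw [LinearMap.comp_apply, LinearEquiv.coe_coe, map_eq_zero_iff _ T.symm.injective,
          hFV ⟨x, hx⟩] at h0
        exact Subtype.ext h0
      exact congrArg Subtype.val ((map_eq_zero_iff U₀ hU₀bij.1).1 h))
    (fun x hx y hy => by
      simp only [LinearMap.comp_apply, LinearEquiv.coe_coe, hTsymm]
      rw [hFV ⟨x, hx⟩, hFV ⟨y, hy⟩, hU₀iso])
  refine ⟨(U.trans T).toLinearMap, fun x y => by simp [hT, hU], fun x => ?_⟩
  simp [hUF x x.2, hFV]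
end

section
/- Let H ∈ ℍ^{n×n} be invertible Hermitian and X ∈ ℍ^{n×n}. If there exists an H-selfadjoint matrix A ∈ ℍ^{n×n} with A² = X^[*] X and Ker X = Ker A, then X admits an H-polar decomposition X = U A with U H-unitary. -/
open Quaternion Matrix

namespace QuaternionWitt

open MulOpposite

variable {n : Type*} [Fintype n]

/-- The sesquilinear form `⟨v, w⟩ = v* H w` on the right `ℍ`-space of column vectors. -/
noncomputable def form (H : Matrix n n ℍ[ℝ]) (v w : n → ℍ[ℝ]) : ℍ[ℝ] :=
  star v ⬝ᵥ H *ᵥ w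

variable {H : Matrix n n ℍ[ℝ]}

lemma form_add_right (u v w : n → ℍ[ℝ]) : form H u (v + w) = form H u v + form H u w := by
  simp [form, mulVec_add]

lemma form_add_left (u v w : n → ℍ[ℝ]) : form H (u + v) w = form H u w + form H v w := by
  simp [form, add_dotProduct]

lemma form_sub_right (u v w : n → ℍ[ℝ]) : form H u (v - w) = form H u v - form H u w := by
  simp [form, mulVec_sub]

lemma form_sub_left (u v w : n → ℍ[ℝ]) : form H (u - v) w = form H u w - form H v w := by
  simp [form, sub_dotProduct]

lemma form_smul_right (u v : n → ℍ[ℝ]) (c : ℍ[ℝ]) : form H u (op c • v) = form H u v * c := by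
  simp [form, mulVec_smul, dotProduct_smul]

lemma star_form (hH : H.IsHermitian) (v w : n → ℍ[ℝ]) : star (form H v w) = form H w v := by
  rw [form, star_dotProduct, star_star, star_mulVec, hH.eq, form, dotProduct_mulVec]

lemma form_smul_left (hH : H.IsHermitian) (u v : n → ℍ[ℝ]) (c : ℍ[ℝ]) :
    form H (op c • u) v = star c * form H u v := by
  rw [← star_form hH, form_smul_right, star_mul, star_form hH]

lemma form_mulVec_mulVec {m : Type*} [Fintype m] (B C : Matrix n m ℍ[ℝ]) (v w : m → ℍ[ℝ]) :
    form H (B *ᵥ v) (C *ᵥ w) = star v ⬝ᵥ (Bᴴ * H * C) *ᵥ w := by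
  simp only [form, star_mulVec, dotProduct_mulVec, vecMul_vecMul, Matrix.mul_assoc]

lemma exists_form_self_eq_coe (hH : H.IsHermitian) (p : n → ℍ[ℝ]) :
    ∃ r : ℝ, form H p p = (r : ℍ[ℝ]) :=
  ⟨_, Quaternion.star_eq_self.mp (star_form hH p p)⟩

lemma exists_ne_zero_star_eq_neg : ∃ b : ℍ[ℝ], b ≠ 0 ∧ star b = -b :=
  ⟨⟨0, 1, 0, 0⟩, fun h ↦ one_ne_zero (congrArg QuaternionAlgebra.imI h),
    Quaternion.star_eq_neg.mpr rfl⟩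

lemma exists_quasiReflection_coeff (hH : H.IsHermitian) (p : n → ℍ[ℝ]) :
    ∃ a : ℍ[ℝ], a ≠ 0 ∧ a + star a + star a * form H p p * a = 0 := by
  obtain ⟨r, hr⟩ := exists_form_self_eq_coe hH p
  rw [hr]
  by_cases h : r = 0
  · obtain ⟨b, hb, hstar⟩ := exists_ne_zero_star_eq_neg
    exact ⟨b, hb, by simp [h, hstar]⟩
  · refine ⟨((-2 / r : ℝ) : ℍ[ℝ]), fun h0 ↦ ?_, ?_⟩
    · exact div_ne_zero (by norm_num) h (Quaternion.coe_injective h0)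
    · rw [Quaternion.star_coe]
      norm_cast
      field_simp
      norm_num

variable [DecidableEq n]

lemma conjTranspose_mul_mul_eq_of_form_eq {U : Matrix n n ℍ[ℝ]}
    (h : ∀ v w, form H (U *ᵥ v) (U *ᵥ w) = form H v w) : Uᴴ * H * U = H := by
  ext1 i j
  have key := h (Pi.single i 1) (Pi.single j 1)
  rw [form_mulVec_mulVec, form] at key
  simpa [← Pi.single_star] using key

/-- The quasi-reflection `v ↦ v + p a ⟨p, v⟩`. -/
noncomputable def quasiReflection (H : Matrix n n ℍ[ℝ]) (p : n → ℍ[ℝ]) (a : ℍ[ℝ]) :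
    Matrix n n ℍ[ℝ] :=
  1 + vecMulVec p (a • (star p ᵥ* H))

lemma quasiReflection_mulVec (p v : n → ℍ[ℝ]) (a : ℍ[ℝ]) :
    quasiReflection H p a *ᵥ v = v + op (a * form H p v) • p := by
  rw [quasiReflection, add_mulVec, one_mulVec, vecMulVec_mulVec, smul_dotProduct,
    ← dotProduct_mulVec, smul_eq_mul, form]

lemma quasiReflection_unitary (hH : H.IsHermitian) {p : n → ℍ[ℝ]} {a : ℍ[ℝ]}
    (ha : a + star a + star a * form H p p * a = 0) :
    (quasiReflection H p a)ᴴ * H * quasiReflection H p a = H := by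
  refine conjTranspose_mul_mul_eq_of_form_eq fun v w ↦ ?_
  simp only [quasiReflection_mulVec, form_add_left, form_add_right, form_smul_right,
    form_smul_left hH, star_mul]
  rw [star_form hH p v]
  calc _ = form H v w +
        form H v p * (a + star a + star a * form H p p * a) * form H p w := by noncomm_ring
    _ = _ := by simp [ha]

/-- If `⟨x, x⟩ = ⟨y, y⟩` and `⟨x - y, x⟩ ≠ 0`, a quasi-reflection along `x - y` maps `x` to `y`. -/
lemma exists_unitary_of_form_sub_ne_zero (hH : H.IsHermitian) {x y : n → ℍ[ℝ]}
    (hxy : form H x x = form H y y) (hne : form H (x - y) x ≠ 0) :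
    ∃ U : Matrix n n ℍ[ℝ], Uᴴ * H * U = H ∧ U *ᵥ x = y ∧
      ∀ w, form H x w = form H y w → U *ᵥ w = w := by
  set c := form H (x - y) x with hc
  have hq : form H (x - y) (x - y) = c + star c := by
    rw [hc, star_form hH]
    simp only [form_sub_left, form_sub_right, ← hxy]
    abel
  have hc' : star c ≠ 0 := star_ne_zero.mpr hne
  refine ⟨quasiReflection H (x - y) (-c⁻¹), quasiReflection_unitary hH ?_, ?_, fun w hw ↦ ?_⟩
  · have h : star c⁻¹ * (c + star c) * c⁻¹ = star c⁻¹ + c⁻¹ := by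
      rw [star_inv₀, mul_add, add_mul, mul_assoc, mul_inv_cancel₀ hne, inv_mul_cancel₀ hc',
        mul_one, one_mul]
    rw [hq, star_neg, neg_mul, neg_mul, mul_neg, neg_neg, h]
    abel
  · rw [quasiReflection_mulVec, ← hc, neg_mul, inv_mul_cancel₀ hne]
    simp
  · rw [quasiReflection_mulVec, form_sub_left, hw]
    simp

/-- A subspace is separated from a vector outside it by a vector of its orthogonal complement. -/
lemma exists_orthogonal_form_ne_zero {K : Matrix n n ℍ[ℝ]} (hH : H.IsHermitian) (hK : H * K = 1)
    {W : Submodule ℍ[ℝ]ᵐᵒᵖ (n → ℍ[ℝ])} {x : n → ℍ[ℝ]} (hx : x ∉ W) :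
    ∃ p, (∀ w ∈ W, form H p w = 0) ∧ form H p x ≠ 0 := by
  obtain ⟨φ, hφx, hφ⟩ := W.exists_le_ker_of_notMem hx
  have hrep : ∀ v, form H (K *ᵥ star fun i ↦ unop (φ (Pi.single i 1))) v = unop (φ v) := by
    intro v
    have hv : v = ∑ i, op (v i) • (Pi.single i 1 : n → ℍ[ℝ]) := by
      ext1 j
      simp [Finset.sum_apply, Pi.single_apply]
    have hKH : Kᴴ * H = 1 := by
      simpa [hH.eq] using congrArg conjTranspose hK
    rw [form, star_mulVec, star_star, ← dotProduct_mulVec, mulVec_mulVec, hKH, one_mulVec]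
    conv_rhs => rw [hv]
    simp [map_sum, dotProduct]
  refine ⟨K *ᵥ star fun i ↦ unop (φ (Pi.single i 1)), fun w hw ↦ ?_, ?_⟩
  · rw [hrep, LinearMap.mem_ker.mp (hφ hw), unop_zero]
  · rwa [hrep, ne_eq, unop_eq_zero_iff]

lemma exists_orthogonal_form_ne_zero₂ {K : Matrix n n ℍ[ℝ]} (hH : H.IsHermitian) (hK : H * K = 1)
    {W : Submodule ℍ[ℝ]ᵐᵒᵖ (n → ℍ[ℝ])} {x y : n → ℍ[ℝ]} (hx : x ∉ W) (hy : y ∉ W) :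
    ∃ p, (∀ w ∈ W, form H p w = 0) ∧ form H p x ≠ 0 ∧ form H p y ≠ 0 := by
  obtain ⟨p, hpW, hpx⟩ := exists_orthogonal_form_ne_zero hH hK hx
  obtain ⟨q, hqW, hqy⟩ := exists_orthogonal_form_ne_zero hH hK hy
  by_cases hpy : form H p y = 0
  · by_cases hqx : form H q x = 0
    · refine ⟨p + q, fun w hw ↦ ?_, ?_, ?_⟩
      · rw [form_add_left, hpW w hw, hqW w hw, add_zero]
      · rwa [form_add_left, hqx, add_zero]
      · rwa [form_add_left, hpy, zero_add]
    · exact ⟨q, hqW, hqx, hqy⟩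
  · exact ⟨p, hpW, hpx, hpy⟩

/-- Extension by one dimension of the identity isometry of a subspace `W`. -/
lemma exists_unitary_fixing {K : Matrix n n ℍ[ℝ]} (hH : H.IsHermitian) (hK : H * K = 1)
    {W : Submodule ℍ[ℝ]ᵐᵒᵖ (n → ℍ[ℝ])} {x y : n → ℍ[ℝ]} (hx : x ∉ W) (hy : y ∉ W)
    (hxy : form H x x = form H y y) (hW : ∀ w ∈ W, form H x w = form H y w) :
    ∃ U : Matrix n n ℍ[ℝ], Uᴴ * H * U = H ∧ U *ᵥ x = y ∧ ∀ w ∈ W, U *ᵥ w = w := by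
  by_cases hu : form H (x - y) x = 0
  · obtain ⟨p, hpW, hpx, hpy⟩ := exists_orthogonal_form_ne_zero₂ hH hK hx hy
    obtain ⟨a, ha0, ha⟩ := exists_quasiReflection_coeff hH p
    set T := quasiReflection H p a
    have hT : Tᴴ * H * T = H := quasiReflection_unitary hH ha
    have hTW : ∀ w ∈ W, T *ᵥ w = w := fun w hw ↦ by
      simp [T, quasiReflection_mulVec, hpW w hw]
    have hform : ∀ v w, form H (T *ᵥ v) (T *ᵥ w) = form H v w := fun v w ↦ by
      rw [form_mulVec_mulVec, hT, form]
    have hne : form H (T *ᵥ x - y) (T *ᵥ x) ≠ 0 := by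
      have hyx : form H y x = form H x x := by
        rw [form_sub_left, sub_eq_zero] at hu
        exact hu.symm
      have : form H (T *ᵥ x - y) (T *ᵥ x) = -(star (form H p y) * a * form H p x) := by
        rw [form_sub_left, hform, quasiReflection_mulVec, form_add_right, form_smul_right, hyx,
          star_form hH]
        noncomm_ring
      rw [this]
      exact neg_ne_zero.mpr (mul_ne_zero (mul_ne_zero (star_ne_zero.mpr hpy) ha0) hpx)
    obtain ⟨S, hS, hSx, hSW⟩ := exists_unitary_of_form_sub_ne_zero hH
      ((hform x x).trans hxy) hne
    refine ⟨S * T, ?_, ?_, fun w hw ↦ ?_⟩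
    · calc (S * T)ᴴ * H * (S * T) = Tᴴ * (Sᴴ * H * S) * T := by
            simp only [conjTranspose_mul, Matrix.mul_assoc]
        _ = H := by rw [hS, hT]
    · rw [← mulVec_mulVec, hSx]
    · rw [← mulVec_mulVec, hTW w hw]
      refine hSW w ?_
      rw [← hW w hw, ← hform x w, hTW w hw]
  · obtain ⟨U, hU, hUx, hUW⟩ := exists_unitary_of_form_sub_ne_zero hH hxy hu
    exact ⟨U, hU, hUx, fun w hw ↦ hUW w (hW w hw)⟩

/-- The Witt extension theorem: an isometry between the images of `B` and `C` (expressed by the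
equality of kernels and of Gram matrices) extends to an `H`-unitary matrix. -/
theorem exists_unitary_mul_eq {m : Type*} [Fintype m] [DecidableEq m] {K : Matrix n n ℍ[ℝ]}
    (hH : H.IsHermitian) (hK : H * K = 1) (hK' : K * H = 1) {B C : Matrix n m ℍ[ℝ]}
    (hBC : Bᴴ * H * B = Cᴴ * H * C) (hker : ∀ v, B *ᵥ v = 0 ↔ C *ᵥ v = 0) :
    ∃ U : Matrix n n ℍ[ℝ], Uᴴ * H * U = H ∧ U * B = C := by
  classical
  have hform : ∀ v w, form H (B *ᵥ v) (B *ᵥ w) = form H (C *ᵥ v) (C *ᵥ w) := fun v w ↦ by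
    rw [form_mulVec_mulVec, form_mulVec_mulVec, hBC]
  have hker' : ∀ v w, B *ᵥ v = B *ᵥ w ↔ C *ᵥ v = C *ᵥ w := fun v w ↦ by
    rw [← sub_eq_zero, ← mulVec_sub, hker, mulVec_sub, sub_eq_zero]
  have hspan : ∀ s : Finset (m → ℍ[ℝ]), ∃ U : Matrix n n ℍ[ℝ], Uᴴ * H * U = H ∧
      ∀ e ∈ Submodule.span ℍ[ℝ]ᵐᵒᵖ (s : Set (m → ℍ[ℝ])), U *ᵥ B *ᵥ e = C *ᵥ e := by
    intro s
    induction s using Finset.induction_on with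
    | empty => exact ⟨1, by simp, by simp⟩
    | insert e s _ ih =>
      obtain ⟨U, hU, hUs⟩ := ih
      suffices h : ∃ V : Matrix n n ℍ[ℝ], Vᴴ * H * V = H ∧ V *ᵥ B *ᵥ e = C *ᵥ e ∧
          ∀ t ∈ Submodule.span ℍ[ℝ]ᵐᵒᵖ (s : Set (m → ℍ[ℝ])), V *ᵥ B *ᵥ t = C *ᵥ t by
        obtain ⟨V, hV, hVe, hVs⟩ := h
        refine ⟨V, hV, fun t ht ↦ ?_⟩
        rw [Finset.coe_insert, Submodule.mem_span_insert] at ht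
        obtain ⟨c, z, hz, rfl⟩ := ht
        simp only [mulVec_add, mulVec_smul, hVe, hVs z hz]
      have hUinj : ∀ v w, U *ᵥ v = U *ᵥ w → v = w := fun v w h ↦ by
        have hinv : K * Uᴴ * H * U = 1 := by
          rw [Matrix.mul_assoc K, Matrix.mul_assoc K, hU, hK']
        simpa [mulVec_mulVec, hinv] using congrArg ((K * Uᴴ * H) *ᵥ ·) h
      set W := (Submodule.span ℍ[ℝ]ᵐᵒᵖ (s : Set (m → ℍ[ℝ]))).map (mulVecBilin ℕ ℍ[ℝ]ᵐᵒᵖ C)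
      by_cases hmem : C *ᵥ e ∈ W
      · obtain ⟨t, ht, hte⟩ := hmem
        have hte' : C *ᵥ t = C *ᵥ e := hte
        refine ⟨U, hU, ?_, hUs⟩
        rw [← hte', ← hUs t ht, (hker' t e).mpr hte']
      · have hx : U *ᵥ B *ᵥ e ∉ W := by
          rintro ⟨t, ht, hte⟩
          have hte' : C *ᵥ t = U *ᵥ B *ᵥ e := hte
          rw [← hUs t ht] at hte'
          exact hmem ⟨t, ht, (hker' t e).mp (hUinj _ _ hte')⟩
        have hUform : ∀ v w, form H (U *ᵥ v) (U *ᵥ w) = form H v w := fun v w ↦ by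
          rw [form_mulVec_mulVec, hU, form]
        obtain ⟨V, hV, hVe, hVW⟩ := exists_unitary_fixing hH hK hx hmem
          (by rw [hUform, hform]) (by
            rintro _ ⟨t, ht, rfl⟩
            change form H _ (C *ᵥ t) = form H _ (C *ᵥ t)
            rw [← hform, ← hUs t ht, hUform])
        refine ⟨V * U, ?_, ?_, fun t ht ↦ ?_⟩
        · calc (V * U)ᴴ * H * (V * U) = Uᴴ * (Vᴴ * H * V) * U := by
                simp only [conjTranspose_mul, Matrix.mul_assoc]
            _ = H := by rw [hV, hU]
        · rw [← mulVec_mulVec, hVe]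
        · rw [← mulVec_mulVec, hUs t ht]
          exact hVW _ ⟨t, ht, rfl⟩
  obtain ⟨U, hU, hUs⟩ := hspan (Finset.univ.image fun i ↦ Pi.single i 1)
  refine ⟨U, hU, ?_⟩
  ext1 i j
  have key := congrFun (hUs (Pi.single j 1) (Submodule.subset_span (by simp))) i
  rwa [mulVec_mulVec, mulVec_single_one, mulVec_single_one] at key

end QuaternionWitt

theorem stmt18 {n : ℕ} (H K X A : Matrix (Fin n) (Fin n) ℍ[ℝ])
    (hH : H.IsHermitian) (hK : H * K = 1) (hK' : K * H = 1)
    (hA : K * Aᴴ * H = A)                 -- `A` is `H`-selfadjoint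
    (hsq : A * A = K * Xᴴ * H * X)        -- `A² = X^[*] X`
    (hker : ∀ v : Fin n → ℍ[ℝ], X *ᵥ v = 0 ↔ A *ᵥ v = 0) :
    ∃ U : Matrix (Fin n) (Fin n) ℍ[ℝ], Uᴴ * H * U = H ∧ X = U * A := by
  have hgram : Aᴴ * H * A = Xᴴ * H * X :=
    calc Aᴴ * H * A = H * (K * Aᴴ * H) * A := by
          simp only [← Matrix.mul_assoc, hK, Matrix.one_mul]
      _ = H * (A * A) := by rw [hA, Matrix.mul_assoc]
      _ = Xᴴ * H * X := by rw [hsq]; simp only [← Matrix.mul_assoc, hK, Matrix.one_mul]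
  obtain ⟨U, hU, hUA⟩ :=
    QuaternionWitt.exists_unitary_mul_eq hH hK hK' hgram fun v ↦ (hker v).symm
  exact ⟨U, hU, hUA.symm⟩
end
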